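/- arXiv:1805.06720 — 2 statements merged into one kernel-verified Lean document; each statement's English description precedes it below -/
import Mathlib

section
/- If p is a lattice norm on ℝ² with p((1,0)) = 1 and Φ is an Orlicz function satisfying lim_{u→∞} Φ(u)/u = +∞, then for every x ∈ L^Φ(μ) with x ≠ 0 (μ-a.e.) there exists l ∈ (0,∞) such that ‖x‖_{Φ,p} = (1/l)·p((1, I_Φ(lx))); that is, the defining infimum is attained. -/
open MeasureTheory Filter

noncomputable section

/-- The Orlicz modular `I_Φ(x) = ∫ Φ(x t) dμ` (valued in `[0,∞]`). -/
def Iphi {Ω : Type*} [MeasurableSpace Ω] (μ : Measure Ω) (Φ : ℝ → ℝ) (x : Ω → ℝ) : ENNReal :=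
  ∫⁻ t, ENNReal.ofReal (Φ (x t)) ∂μ

/-- One term `(1/k)·p((1, I_Φ(kx)))` of the defining infimum; value `∞` if `I_Φ(kx) = ∞`. -/
def aTerm {Ω : Type*} [MeasurableSpace Ω] (μ : Measure Ω) (Φ : ℝ → ℝ) (p : ℝ × ℝ → ℝ)
    (x : Ω → ℝ) (k : ℝ) : ENNReal :=
  if Iphi μ Φ (fun t => k * x t) = ⊤ then ⊤
  else ENNReal.ofReal ((1 / k) * p (1, (Iphi μ Φ (fun t => k * x t)).toReal))

/-- The norm `‖x‖_{Φ,p} = inf_{k>0} (1/k)·p((1, I_Φ(kx)))`. -/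
def aNorm {Ω : Type*} [MeasurableSpace Ω] (μ : Measure Ω) (Φ : ℝ → ℝ) (p : ℝ × ℝ → ℝ)
    (x : Ω → ℝ) : ENNReal :=
  ⨅ (k : ℝ) (_ : 0 < k), aTerm μ Φ p x k

/-- `Φ` is an Orlicz function: convex, even, vanishing at `0`, nonnegative, not identically `0`. -/
def IsOrlicz (Φ : ℝ → ℝ) : Prop :=
  ConvexOn ℝ Set.univ Φ ∧ (∀ u, Φ (-u) = Φ u) ∧ Φ 0 = 0 ∧ (∀ u, 0 ≤ Φ u) ∧ ∃ u, Φ u ≠ 0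

/-- `p` is a lattice norm on `ℝ²`: a norm which is monotone with respect to the
coordinatewise order on absolute values. -/
def IsLatticeNorm (p : ℝ × ℝ → ℝ) : Prop :=
  (∀ a b : ℝ × ℝ, p (a + b) ≤ p a + p b) ∧ (∀ (c : ℝ) (a : ℝ × ℝ), p (c • a) = |c| * p a) ∧
  (∀ a : ℝ × ℝ, p a = 0 → a = 0) ∧
  (∀ a b : ℝ × ℝ, |a.1| ≤ |b.1| → |a.2| ≤ |b.2| → p a ≤ p b)

/-- `p` is strictly monotone: `0 ≤ a ≤ b` coordinatewise and `a ≠ b` imply `p a < p b`. -/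
def StrictMonoNorm (p : ℝ × ℝ → ℝ) : Prop :=
  ∀ a b : ℝ × ℝ, 0 ≤ a.1 → 0 ≤ a.2 → a.1 ≤ b.1 → a.2 ≤ b.2 → a ≠ b → p a < p b

/-- Membership in the Orlicz space `L^Φ(μ)`. -/
def MemLphi {Ω : Type*} [MeasurableSpace Ω] (μ : Measure Ω) (Φ : ℝ → ℝ) (x : Ω → ℝ) : Prop :=
  Measurable x ∧ ∃ l : ℝ, 0 < l ∧ Iphi μ Φ (fun t => l * x t) ≠ ⊤

/-- Membership in the space `E^Φ(μ)` of order continuous elements. -/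
def MemEphi {Ω : Type*} [MeasurableSpace Ω] (μ : Measure Ω) (Φ : ℝ → ℝ) (x : Ω → ℝ) : Prop :=
  Measurable x ∧ ∀ l : ℝ, 0 < l → Iphi μ Φ (fun t => l * x t) ≠ ⊤

/-- `a(Φ) = sup{u ≥ 0 : Φ(u) = 0}`. -/
def aPhi (Φ : ℝ → ℝ) : ℝ := sSup {u : ℝ | 0 ≤ u ∧ Φ u = 0}

/-- `K(x) = {k > 0 : ‖x‖_{Φ,p} = (1/k)·p((1, I_Φ(kx)))}`. -/
def Kset {Ω : Type*} [MeasurableSpace Ω] (μ : Measure Ω) (Φ : ℝ → ℝ) (p : ℝ × ℝ → ℝ)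
    (x : Ω → ℝ) : Set ℝ :=
  {k : ℝ | 0 < k ∧ aNorm μ Φ p x = aTerm μ Φ p x k}

/-- Condition `Δ₂(ℝ₊)`: `Φ(2u) ≤ K·Φ(u)` for all `u ≥ 0`. -/
def Delta2 (Φ : ℝ → ℝ) : Prop := ∃ K : ℝ, 0 < K ∧ ∀ u : ℝ, 0 ≤ u → Φ (2 * u) ≤ K * Φ u

/-- A non-atomic measure: every set of positive measure has a measurable subset of
strictly smaller positive measure. -/
def NonAtomic {Ω : Type*} [MeasurableSpace Ω] (μ : Measure Ω) : Prop :=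
  ∀ A : Set Ω, MeasurableSet A → 0 < μ A →
    ∃ B ⊆ A, MeasurableSet B ∧ 0 < μ B ∧ μ B < μ A

/-- The modulus of monotonicity of `(ℝ², p)`:
`δ_{m,p}(ε) = inf{1 − p(b − a) : 0 ≤ a ≤ b coordinatewise, p a ≥ ε, p b = 1}`. -/
def deltaM (p : ℝ × ℝ → ℝ) (ε : ℝ) : ℝ :=
  sInf {d : ℝ | ∃ a b : ℝ × ℝ, 0 ≤ a.1 ∧ 0 ≤ a.2 ∧ a.1 ≤ b.1 ∧ a.2 ≤ b.2 ∧
    ε ≤ p a ∧ p b = 1 ∧ d = 1 - p (b - a)}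

open Topology

theorem IsOrlicz.continuous {Φ : ℝ → ℝ} (hΦ : IsOrlicz Φ) : Continuous Φ :=
  continuousOn_univ.1 (hΦ.1.continuousOn isOpen_univ)

theorem IsOrlicz.le_of_abs_le {Φ : ℝ → ℝ} (hΦ : IsOrlicz Φ) {a b : ℝ} (h : |a| ≤ b) :
    Φ a ≤ Φ b := by
  have := hΦ.1.le_max_of_mem_Icc (x := -b) (y := b) (Set.mem_univ _) (Set.mem_univ _)
    (abs_le.1 h)
  rwa [hΦ.2.1, max_self] at this

theorem IsOrlicz.le_of_abs_le_abs {Φ : ℝ → ℝ} (hΦ : IsOrlicz Φ) {a b : ℝ} (h : |a| ≤ |b|) :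
    Φ a ≤ Φ b := by
  refine (hΦ.le_of_abs_le h).trans_eq ?_
  rcases abs_choice b with hb | hb <;> rw [hb]
  exact hΦ.2.1 b

theorem lowerSemicontinuous_Iphi_mul {Ω : Type*} [MeasurableSpace Ω] (μ : Measure Ω) {Φ : ℝ → ℝ}
    (hΦ : Continuous Φ) {x : Ω → ℝ} (hx : Measurable x) :
    LowerSemicontinuous fun k : ℝ => Iphi μ Φ fun t => k * x t := by
  intro k₀
  refine lowerSemicontinuousAt_iff_le_liminf.2 ?_
  refine le_trans (lintegral_mono fun t => ?_) (lintegral_liminf_le fun k => ?_)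
  · have h : Continuous fun k : ℝ => ENNReal.ofReal (Φ (k * x t)) :=
      ENNReal.continuous_ofReal.comp (hΦ.comp (continuous_mul_const (x t)))
    exact (h.tendsto k₀).liminf_eq.ge
  · exact (hΦ.measurable.comp (hx.const_mul k)).ennreal_ofReal

/-- The extension of `s ↦ p (1, s)` to `[0,∞]`, with value `∞` at `∞`. -/
def extendedSection (p : ℝ × ℝ → ℝ) (s : ENNReal) : ENNReal :=
  if s = ⊤ then ⊤ else ENNReal.ofReal (p (1, s.toReal))

theorem extendedSection_top (p : ℝ × ℝ → ℝ) : extendedSection p ⊤ = ⊤ := if_pos rfl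

theorem extendedSection_of_ne_top (p : ℝ × ℝ → ℝ) {s : ENNReal} (hs : s ≠ ⊤) :
    extendedSection p s = ENNReal.ofReal (p (1, s.toReal)) := if_neg hs

theorem aTerm_eq_mul_extendedSection {Ω : Type*} [MeasurableSpace Ω] (μ : Measure Ω)
    (Φ : ℝ → ℝ) (p : ℝ × ℝ → ℝ) (x : Ω → ℝ) {k : ℝ} (hk : 0 < k) :
    aTerm μ Φ p x k =
      ENNReal.ofReal (1 / k) * extendedSection p (Iphi μ Φ fun t => k * x t) := by
  have hk' : 0 < 1 / k := one_div_pos.2 hk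
  unfold aTerm extendedSection
  split_ifs
  · exact (ENNReal.mul_top (ENNReal.ofReal_pos.2 hk').ne').symm
  · exact ENNReal.ofReal_mul hk'.le

namespace IsLatticeNorm

theorem apply_zero_one_pos {p : ℝ × ℝ → ℝ} (hp : IsLatticeNorm p) : 0 < p (0, 1) := by
  have h0 : p 0 = 0 := by simpa using hp.2.1 0 0
  refine lt_of_le_of_ne (h0 ▸ hp.2.2.2 0 (0, 1) (by simp) (by simp)) fun h => ?_
  simpa using hp.2.2.1 _ h.symm

theorem continuous_section {p : ℝ × ℝ → ℝ} (hp : IsLatticeNorm p) :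
    Continuous fun s : ℝ => p (1, s) := by
  have key (s t : ℝ) : p (1, s) ≤ p (1, t) + p (0, 1) * |s - t| := by
    have h := hp.1 (1, t) ((s - t) • ((0 : ℝ), (1 : ℝ)))
    rw [hp.2.1] at h
    simpa [mul_comm] using h
  refine (LipschitzWith.of_le_add_mul (K := (p (0, 1)).toNNReal) fun s t => ?_).continuous
  rw [Real.dist_eq, Real.coe_toNNReal _ hp.apply_zero_one_pos.le]
  exact key s t

theorem monotone_extendedSection {p : ℝ × ℝ → ℝ} (hp : IsLatticeNorm p) :
    Monotone (extendedSection p) := by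
  intro s t hst
  rcases eq_or_ne t ⊤ with rfl | ht
  · rw [extendedSection_top]
    exact le_top
  · rw [extendedSection_of_ne_top p ht, extendedSection_of_ne_top p (ne_top_of_le_ne_top ht hst)]
    refine ENNReal.ofReal_le_ofReal (hp.2.2.2 _ _ le_rfl ?_)
    simpa using ENNReal.toReal_mono ht hst

theorem mul_le_extendedSection {p : ℝ × ℝ → ℝ} (hp : IsLatticeNorm p) (s : ENNReal) :
    s * ENNReal.ofReal (p (0, 1)) ≤ extendedSection p s := by
  rcases eq_or_ne s ⊤ with rfl | hs
  · rw [extendedSection_top]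
    exact le_top
  · have h := hp.2.1 s.toReal (0, 1)
    rw [abs_of_nonneg ENNReal.toReal_nonneg] at h
    rw [extendedSection_of_ne_top p hs, ← ENNReal.ofReal_toReal hs,
      ← ENNReal.ofReal_mul ENNReal.toReal_nonneg, ← h, ENNReal.toReal_ofReal ENNReal.toReal_nonneg]
    exact ENNReal.ofReal_le_ofReal (hp.2.2.2 _ _ (by simp) (by simp))

theorem one_le_extendedSection {p : ℝ × ℝ → ℝ} (hp : IsLatticeNorm p) (h10 : p (1, 0) = 1)
    (s : ENNReal) : 1 ≤ extendedSection p s := by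
  have h : extendedSection p 0 = 1 := by
    simp [extendedSection_of_ne_top, h10]
  exact h ▸ hp.monotone_extendedSection zero_le

theorem continuous_extendedSection {p : ℝ × ℝ → ℝ} (hp : IsLatticeNorm p) :
    Continuous (extendedSection p) := by
  refine continuous_iff_continuousAt.2 fun s => ?_
  rcases eq_or_ne s ⊤ with rfl | hs
  · have hc : ENNReal.ofReal (p (0, 1)) ≠ 0 := (ENNReal.ofReal_pos.2 hp.apply_zero_one_pos).ne'
    have h : Tendsto (fun s : ENNReal => s * ENNReal.ofReal (p (0, 1))) (𝓝 ⊤) (𝓝 ⊤) := by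
      simpa [ENNReal.top_mul hc] using
        (ENNReal.continuous_mul_const (ENNReal.ofReal_ne_top (r := p (0, 1)))).tendsto ⊤
    rw [ContinuousAt, extendedSection_top]
    exact tendsto_nhds_top_mono' h hp.mul_le_extendedSection
  · have h : ContinuousAt (fun s : ENNReal => ENNReal.ofReal (p (1, s.toReal))) s :=
      (ENNReal.continuous_ofReal.comp hp.continuous_section).continuousAt.comp
        (ENNReal.continuousAt_toReal hs)
    refine h.congr ?_
    filter_upwards [isOpen_ne.mem_nhds hs] with t ht
    exact (extendedSection_of_ne_top p ht).symm

end IsLatticeNorm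

theorem lowerSemicontinuousAt_aTerm {Ω : Type*} [MeasurableSpace Ω] (μ : Measure Ω) {Φ : ℝ → ℝ}
    (hΦ : Continuous Φ) {p : ℝ × ℝ → ℝ} (hp : IsLatticeNorm p) {x : Ω → ℝ} (hx : Measurable x)
    {k : ℝ} (hk : 0 < k) : LowerSemicontinuousAt (aTerm μ Φ p x) k := by
  have hG := lowerSemicontinuousAt_iff_le_liminf.1
    (hp.continuous_extendedSection.comp_lowerSemicontinuous
      (lowerSemicontinuous_Iphi_mul μ hΦ hx) hp.monotone_extendedSection k)
  have hinv : Tendsto (fun k : ℝ => ENNReal.ofReal (1 / k)) (𝓝 k) (𝓝 (ENNReal.ofReal (1 / k))) :=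
    ENNReal.tendsto_ofReal (tendsto_const_nhds.div tendsto_id hk.ne')
  rw [lowerSemicontinuousAt_iff_le_liminf, aTerm_eq_mul_extendedSection μ Φ p x hk]
  refine (mul_le_mul' hinv.liminf_eq.ge hG).trans (ENNReal.le_liminf_mul.trans_eq ?_)
  refine liminf_congr ?_
  filter_upwards [lt_mem_nhds hk] with j hj
  exact (aTerm_eq_mul_extendedSection μ Φ p x hj).symm

theorem exists_pos_measure_le_abs {Ω : Type*} [MeasurableSpace Ω] {μ : Measure Ω} {x : Ω → ℝ}
    (hx0 : ¬ x =ᵐ[μ] 0) : ∃ ε : ℝ, 0 < ε ∧ μ {t | ε ≤ |x t|} ≠ 0 := by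
  by_contra! h
  refine hx0 ?_
  have hall : ∀ᵐ t ∂μ, ∀ n : ℕ, |x t| < 1 / ((n : ℝ) + 1) := by
    refine ae_all_iff.2 fun n => ae_iff.2 ?_
    simpa only [not_lt] using h _ Nat.one_div_pos_of_nat
  filter_upwards [hall] with t ht
  by_contra hne
  obtain ⟨n, hn⟩ := exists_nat_one_div_lt (abs_pos.2 hne)
  exact (hn.trans (ht n)).false

theorem tendsto_aTerm_atTop {Ω : Type*} [MeasurableSpace Ω] {μ : Measure Ω} {Φ : ℝ → ℝ}
    (hΦ : IsOrlicz Φ) (hlim : Tendsto (fun u : ℝ => Φ u / u) atTop atTop) {p : ℝ × ℝ → ℝ}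
    (hp : IsLatticeNorm p) {x : Ω → ℝ} (hx : Measurable x) (hx0 : ¬ x =ᵐ[μ] 0) :
    Tendsto (aTerm μ Φ p x) atTop (𝓝 ⊤) := by
  obtain ⟨ε, hε, hA⟩ := exists_pos_measure_le_abs hx0
  set A : Set Ω := {t | ε ≤ |x t|}
  have hI (k : ℝ) : ENNReal.ofReal (Φ (k * ε)) * μ A ≤ Iphi μ Φ fun t => k * x t := by
    have hAm : MeasurableSet A := measurableSet_le measurable_const hx.abs
    rw [← setLIntegral_const]
    refine (setLIntegral_mono' hAm fun t ht => ?_).trans (setLIntegral_le_lintegral A _)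
    refine ENNReal.ofReal_le_ofReal (hΦ.le_of_abs_le_abs ?_)
    rw [abs_mul, abs_mul, abs_of_pos hε]
    exact mul_le_mul_of_nonneg_left ht (abs_nonneg k)
  have hD : μ A * ENNReal.ofReal (p (0, 1)) ≠ 0 :=
    mul_ne_zero hA (ENNReal.ofReal_pos.2 hp.apply_zero_one_pos).ne'
  have hgrowth : Tendsto (fun k : ℝ => Φ (k * ε) / k) atTop atTop := by
    refine ((hlim.comp (tendsto_id.atTop_mul_const hε)).atTop_mul_const hε).congr fun k => ?_
    simp only [Function.comp_apply, id]
    rw [mul_comm k ε, mul_comm, ← mul_div_assoc, mul_div_mul_left _ _ hε.ne']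
  have hlower := ENNReal.Tendsto.mul_const (ENNReal.tendsto_ofReal_atTop.comp hgrowth)
    (b := μ A * ENNReal.ofReal (p (0, 1))) (Or.inl ENNReal.top_ne_zero)
  rw [ENNReal.top_mul hD] at hlower
  refine tendsto_nhds_top_mono hlower ?_
  filter_upwards [eventually_gt_atTop 0] with k hk
  rw [aTerm_eq_mul_extendedSection μ Φ p x hk, Function.comp_apply, div_eq_mul_one_div,
    mul_comm (Φ _), ENNReal.ofReal_mul (one_div_pos.2 hk).le, mul_assoc, ← mul_assoc _ (μ A)]
  exact mul_le_mul_right ((mul_le_mul_left (hI k) _).trans (hp.mul_le_extendedSection _)) _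

/-- If `p` is a lattice norm on `ℝ²` with `p (1,0) = 1` and `Φ` is an Orlicz function with
`Φ(u)/u → ∞` as `u → ∞`, then for every nonzero `x ∈ L^Φ(μ)` the infimum defining
`‖x‖_{Φ,p}` is attained at some `l ∈ (0,∞)`. -/
theorem stmt2 {Ω : Type*} [MeasurableSpace Ω] (μ : Measure Ω) [SigmaFinite μ]
    (Φ : ℝ → ℝ) (hΦ : IsOrlicz Φ)
    (hlim : Tendsto (fun u : ℝ => Φ u / u) atTop atTop)
    (p : ℝ × ℝ → ℝ) (hp : IsLatticeNorm p) (h10 : p (1, 0) = 1)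
    (x : Ω → ℝ) (hx : MemLphi μ Φ x) (hx0 : ¬ x =ᵐ[μ] 0) :
    ∃ l : ℝ, 0 < l ∧ aNorm μ Φ p x = aTerm μ Φ p x l := by
  obtain ⟨hxm, l₀, hl₀, hfin⟩ := hx
  have hfin' : aTerm μ Φ p x l₀ ≠ ⊤ := by
    rw [aTerm, if_neg hfin]
    exact ENNReal.ofReal_ne_top
  obtain ⟨b, hb⟩ := eventually_atTop.1
    ((tendsto_aTerm_atTop hΦ hlim hp hxm hx0).eventually_const_lt hfin'.lt_top)
  set C := (aTerm μ Φ p x l₀).toReal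
  have hC : 0 ≤ C := ENNReal.toReal_nonneg
  set a := min l₀ (1 / (C + 1))
  have ha : 0 < a := lt_min hl₀ (by positivity)
  have hsmall {k : ℝ} (hk : 0 < k) (hka : k ≤ a) : aTerm μ Φ p x l₀ ≤ aTerm μ Φ p x k := by
    have hkC : C ≤ 1 / k := by
      have := (le_one_div hk (by positivity)).1 (hka.trans (min_le_right _ _))
      linarith
    rw [aTerm_eq_mul_extendedSection μ Φ p x hk, ← ENNReal.ofReal_toReal hfin']
    exact (ENNReal.ofReal_le_ofReal hkC).trans
      (le_mul_of_one_le_right' (hp.one_le_extendedSection h10 _))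
  have hmem : l₀ ∈ Set.Icc a (max b l₀) := ⟨min_le_left _ _, le_max_right _ _⟩
  obtain ⟨l, hl, hmin⟩ := LowerSemicontinuousOn.exists_isMinOn ⟨l₀, hmem⟩ isCompact_Icc
    fun k hk => (lowerSemicontinuousAt_aTerm μ hΦ.continuous hp hxm
      (ha.trans_le hk.1)).lowerSemicontinuousWithinAt _
  refine ⟨l, ha.trans_le hl.1, le_antisymm (iInf₂_le l (ha.trans_le hl.1)) ?_⟩
  refine le_iInf₂ fun k hk => ?_
  rcases le_total k a with hka | hak
  · exact (hmin hmem).trans (hsmall hk hka)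
  rcases le_total k (max b l₀) with hkb | hbk
  · exact hmin ⟨hak, hkb⟩
  · exact (hmin hmem).trans (hb k ((le_max_left _ _).trans hbk)).le
end
end

section
/- Let μ be σ-finite, non-atomic with μ(Ω) = ∞, let p be a lattice norm on ℝ² with p((1,0)) = p((0,1)) = 1, and let Φ be an Orlicz function that does not satisfy condition Δ₂(ℝ₊). Then (L^Φ(μ), ‖·‖_{Φ,p}) contains an order linearly almost isometric copy of ℓ^∞: for every ε > 0 there exists a linear operator P_ε : ℓ^∞ → L^Φ(μ) such that P_ε z ≥ 0 μ-a.e. whenever z ≥ 0, and ‖z‖_∞ ≤ ‖P_ε z‖_{Φ,p} ≤ (1+ε)·‖z‖_∞ for every z ∈ ℓ^∞. -/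
open MeasureTheory Filter

noncomputable section

section NonAtomicMeasure

variable {Ω : Type*} [MeasurableSpace Ω] {μ : Measure Ω}

lemma NonAtomic.exists_subset_two_mul_le (hna : NonAtomic μ) {A : Set Ω}
    (hA : MeasurableSet A) (hpos : 0 < μ A) :
    ∃ D ⊆ A, MeasurableSet D ∧ 0 < μ D ∧ 2 * μ D ≤ μ A := by
  obtain ⟨B, hBA, hB, hB0, hlt⟩ := hna A hA hpos
  have hadd : μ (A \ B) + μ B = μ A := by
    simpa [Set.inter_eq_self_of_subset_right hBA] using measure_sdiff_add_inter A hB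
  have hdiff : 0 < μ (A \ B) := by
    rw [pos_iff_ne_zero]
    intro h
    rw [h, zero_add] at hadd
    exact hlt.ne hadd
  rcases le_total (μ B) (μ (A \ B)) with h | h
  · exact ⟨B, hBA, hB, hB0, by rw [two_mul, ← hadd]; gcongr⟩
  · exact ⟨A \ B, Set.sdiff_subset, hA.diff hB, hdiff, by rw [two_mul, ← hadd]; gcongr⟩

lemma NonAtomic.exists_subset_measure_le [SigmaFinite μ] (hna : NonAtomic μ) {A : Set Ω}
    (hA : MeasurableSet A) (hpos : 0 < μ A) {δ : ENNReal} (hδ : 0 < δ) :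
    ∃ D ⊆ A, MeasurableSet D ∧ 0 < μ D ∧ μ D ≤ δ := by
  obtain ⟨E, hE, hEA, hE0, hEfin⟩ := Measure.exists_subset_measure_lt_top hA hpos
  have key : ∀ n : ℕ, ∃ D ⊆ A, MeasurableSet D ∧ 0 < μ D ∧ 2 ^ n * μ D ≤ μ E := by
    intro n
    induction n with
    | zero => exact ⟨E, hEA, hE, hE0, by simp⟩
    | succ n ih =>
      obtain ⟨D, hDA, hD, hD0, hle⟩ := ih
      obtain ⟨D', hD'D, hD', hD'0, hle'⟩ := hna.exists_subset_two_mul_le hD hD0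
      refine ⟨D', hD'D.trans hDA, hD', hD'0, ?_⟩
      calc 2 ^ (n + 1) * μ D' = 2 ^ n * (2 * μ D') := by ring
        _ ≤ 2 ^ n * μ D := by gcongr
        _ ≤ μ E := hle
  obtain ⟨n, hn⟩ := ENNReal.exists_nat_mul_gt hδ.ne' hEfin.ne
  obtain ⟨D, hDA, hD, hD0, hle⟩ := key n
  refine ⟨D, hDA, hD, hD0, ?_⟩
  by_contra! hlt
  have h2 : (n : ENNReal) ≤ 2 ^ n := by exact_mod_cast Nat.lt_two_pow_self.le
  exact absurd (hn.trans_le ((mul_le_mul' h2 hlt.le).trans hle)) (lt_irrefl _)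

/-- Sierpiński's theorem: a non-atomic measure takes all intermediate values. -/
lemma NonAtomic.exists_subset_measure_eq [SigmaFinite μ] (hna : NonAtomic μ) {B : Set Ω}
    (hB : MeasurableSet B) {c : ENNReal} (hc : c ≠ ⊤) (hcB : c ≤ μ B) :
    ∃ A ⊆ B, MeasurableSet A ∧ μ A = c := by
  let S := {A : Set Ω // MeasurableSet A ∧ A ⊆ B ∧ μ A ≤ c}
  have step : ∀ A : S, ∃ A' : S, A.1 ⊆ A'.1 ∧
      ∀ E : S, A.1 ⊆ E.1 → μ A.1 + μ E.1 ≤ 2 * μ A'.1 := by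
    intro A
    set s := ⨆ E : {E : S // A.1 ⊆ E.1}, μ E.1.1 with hs
    have hle : ∀ E : S, A.1 ⊆ E.1 → μ E.1 ≤ s := fun E hE =>
      le_iSup (fun E : {E : S // A.1 ⊆ E.1} => μ E.1.1) ⟨E, hE⟩
    have hsc : s ≤ c := iSup_le fun E => E.1.2.2.2
    rcases (hle A subset_rfl).eq_or_lt with h | h
    · refine ⟨A, subset_rfl, fun E hE => ?_⟩
      rw [two_mul]
      exact add_le_add_right ((hle E hE).trans h.ge) _
    · have hlt : (μ A.1 + s) / 2 < s := by
        rw [ENNReal.div_lt_iff (by simp) (by simp), mul_two]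
        exact ENNReal.add_lt_add_right (ne_top_of_le_ne_top hc hsc) h
      obtain ⟨A', hA'⟩ := lt_iSup_iff.1 hlt
      refine ⟨A'.1, A'.2, fun E hE => ?_⟩
      rw [ENNReal.div_lt_iff (by simp) (by simp), mul_comm] at hA'
      exact (add_le_add_right (hle E hE) _).trans hA'.le
  choose next hsub hnext using step
  let A : ℕ → S := fun n => next^[n] ⟨∅, MeasurableSet.empty, Set.empty_subset _, by simp⟩
  have hA : ∀ n, A (n + 1) = next (A n) := fun n => Function.iterate_succ_apply' _ _ _
  have hmono : Monotone fun n => (A n).1 := monotone_nat_of_le_succ fun n => by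
    rw [hA]; exact hsub _
  have hlim : Tendsto (fun n => μ (A n).1) atTop (nhds (μ (⋃ n, (A n).1))) :=
    tendsto_measure_iUnion_atTop hmono
  set U := ⋃ n, (A n).1 with hU
  have hUm : MeasurableSet U := MeasurableSet.iUnion fun n => (A n).2.1
  have hUB : U ⊆ B := Set.iUnion_subset fun n => (A n).2.2.1
  have hUc : μ U ≤ c := le_of_tendsto' hlim fun n => (A n).2.2.2
  refine ⟨U, hUB, hUm, hUc.antisymm ?_⟩
  by_contra! hlt
  have hUfin : μ U ≠ ⊤ := hlt.ne_top
  have hpos : 0 < μ (B \ U) := by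
    rw [measure_sdiff hUB hUm.nullMeasurableSet hUfin]
    exact tsub_pos_of_lt (hlt.trans_le hcB)
  obtain ⟨D, hDB, hD, hD0, hDle⟩ :=
    hna.exists_subset_measure_le (hB.diff hUm) hpos (tsub_pos_of_lt hlt)
  have hUD : μ (U ∪ D) = μ U + μ D :=
    measure_union (Set.disjoint_left.2 fun t ht h => (hDB h).2 ht) hD
  let E : S := ⟨U ∪ D, hUm.union hD, Set.union_subset hUB (hDB.trans Set.sdiff_subset), by
    rw [hUD]
    calc μ U + μ D ≤ μ U + (c - μ U) := by gcongr
      _ = c := add_tsub_cancel_of_le hUc⟩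
  have hbound : ∀ n, μ (A n).1 + (μ U + μ D) ≤ 2 * μ U := by
    intro n
    rw [← hUD]
    refine (hnext (A n) E ((Set.subset_iUnion (fun n => (A n).1) n).trans
      Set.subset_union_left)).trans ?_
    rw [← hA]
    gcongr
    exact Set.subset_iUnion (fun n => (A n).1) (n + 1)
  have hfinal : μ U + (μ U + μ D) ≤ 2 * μ U :=
    le_of_tendsto' (hlim.add tendsto_const_nhds) hbound
  rw [two_mul, ENNReal.add_le_add_iff_left hUfin] at hfinal
  exact absurd hfinal (ENNReal.lt_add_right hUfin hD0.ne').not_ge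

/-- An infinite non-atomic measure space carries a label `L : Ω → ℕ` whose nonzero level sets
have prescribed finite measures. -/
lemma NonAtomic.exists_label [SigmaFinite μ] (hna : NonAtomic μ) (hμ : μ Set.univ = ⊤)
    (c : ℕ → ENNReal) (hc : ∀ m, c m ≠ ⊤) :
    ∃ L : Ω → ℕ, Measurable L ∧ ∀ m, μ (L ⁻¹' {m + 1}) = c m := by
  let S := {B : Set Ω // MeasurableSet B ∧ μ B ≠ ⊤}
  have step : ∀ (m : ℕ) (B : S), ∃ B' : S, B.1 ⊆ B'.1 ∧ μ (B'.1 \ B.1) = c m := by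
    intro m B
    have htop : μ B.1ᶜ = ⊤ := by
      rw [measure_compl B.2.1 B.2.2, hμ, ENNReal.top_sub B.2.2]
    obtain ⟨A, hAB, hA, hAc⟩ :=
      hna.exists_subset_measure_eq B.2.1.compl (hc m) (le_top.trans htop.ge)
    have hdisj : Disjoint B.1 A := Set.disjoint_left.2 fun t ht h => hAB h ht
    refine ⟨⟨B.1 ∪ A, B.2.1.union hA, ?_⟩, Set.subset_union_left, ?_⟩
    · exact (measure_union_lt_top B.2.2.lt_top (hAc ▸ (hc m).lt_top)).ne
    · rw [Set.union_sdiff_cancel_left (Set.disjoint_iff.1 hdisj), hAc]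
  choose next hsub hnext using step
  let B : ℕ → S := fun n => Nat.rec ⟨∅, MeasurableSet.empty, by simp⟩ next n
  have hmono : Monotone fun n => (B n).1 := monotone_nat_of_le_succ fun n => hsub n (B n)
  classical
  let q : Ω → ℕ → Prop := fun t n => t ∈ (B n).1 ∨ t ∉ ⋃ k, (B k).1
  have hq : ∀ t, ∃ n, q t n := by
    intro t
    by_cases h : t ∈ ⋃ k, (B k).1
    · obtain ⟨k, hk⟩ := Set.mem_iUnion.1 h
      exact ⟨k, Or.inl hk⟩
    · exact ⟨0, Or.inr h⟩
  refine ⟨fun t => Nat.find (hq t), measurable_find hq fun n =>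
    (B n).2.1.union (MeasurableSet.iUnion fun k => (B k).2.1).compl, fun m => ?_⟩
  rw [← hnext m (B m)]
  congr 1
  ext t
  simp only [Set.mem_preimage, Set.mem_singleton_iff, Nat.find_eq_iff, Set.mem_sdiff]
  constructor
  · rintro ⟨h1, h2⟩
    have h3 := h2 m (Nat.lt_succ_self m)
    refine ⟨?_, fun h => h3 (Or.inl h)⟩
    exact h1.resolve_right fun h => h3 (Or.inr h)
  · rintro ⟨h1, h2⟩
    refine ⟨Or.inl h1, fun n hn h => ?_⟩
    rcases h with h | h
    · exact h2 (hmono (Nat.lt_succ_iff.1 hn) h)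
    · exact h (Set.mem_iUnion.2 ⟨m + 1, h1⟩)

end NonAtomicMeasure

lemma IsOrlicz.mono {Φ : ℝ → ℝ} (hΦ : IsOrlicz Φ) {u v : ℝ} (h : |u| ≤ |v|) : Φ u ≤ Φ v := by
  obtain ⟨hconv, heven, h0, hnonneg, -⟩ := hΦ
  have habs : ∀ x, Φ |x| = Φ x := fun x => by
    rcases abs_choice x with h | h <;> rw [h]
    exact heven x
  rw [← habs u, ← habs v]
  rcases (abs_nonneg v).eq_or_lt with hv | hv
  · rw [le_antisymm (hv ▸ h) (abs_nonneg u), ← hv]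
  · have hr : |u| / |v| ≤ 1 := (div_le_one hv).2 h
    have key := hconv.2 (Set.mem_univ |v|) (Set.mem_univ 0) (div_nonneg (abs_nonneg u) hv.le)
      (sub_nonneg.2 hr) (add_sub_cancel _ _)
    simp only [smul_eq_mul, mul_zero, add_zero, h0, div_mul_cancel₀ _ hv.ne'] at key
    exact key.trans (mul_le_of_le_one_left (hnonneg _) hr)

/-- Failure of `Δ₂` for the factor `2` implies its failure for every factor `1 + δ`. -/
lemma exists_lt_of_not_delta2 {Φ : ℝ → ℝ} (hΦ : IsOrlicz Φ) (hΔ : ¬ Delta2 Φ) {δ K : ℝ}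
    (hδ : 0 < δ) (hK : 0 < K) : ∃ u, 0 ≤ u ∧ K * Φ u < Φ ((1 + δ) * u) := by
  by_contra! hcon
  refine hΔ ?_
  obtain ⟨n, hn⟩ := pow_unbounded_of_one_lt 2 (lt_add_of_pos_right 1 hδ)
  refine ⟨K ^ n, pow_pos hK n, fun u hu => ?_⟩
  have iter : ∀ n : ℕ, Φ ((1 + δ) ^ n * u) ≤ K ^ n * Φ u := by
    intro n
    induction n with
    | zero => simp
    | succ n ih =>
      calc Φ ((1 + δ) ^ (n + 1) * u) = Φ ((1 + δ) * ((1 + δ) ^ n * u)) := by ring_nf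
        _ ≤ K * Φ ((1 + δ) ^ n * u) := hcon _ (by positivity)
        _ ≤ K * (K ^ n * Φ u) := by gcongr
        _ = K ^ (n + 1) * Φ u := by ring
  refine (hΦ.mono ?_).trans (iter n)
  rw [abs_of_nonneg (by positivity), abs_of_nonneg (by positivity)]
  gcongr

lemma exists_height_weight {Φ : ℝ → ℝ} (hΦ : IsOrlicz Φ) (hΔ : ¬ Delta2 Φ) {δ : ℝ}
    (hδ : 0 < δ) {e : ENNReal} (he : 0 < e) :
    ∃ (u : ℝ) (c : ENNReal), 0 ≤ u ∧ c ≠ ⊤ ∧ ENNReal.ofReal (Φ u) * c ≤ e ∧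
      1 ≤ ENNReal.ofReal (Φ ((1 + δ) * u)) * c := by
  obtain ⟨r, -, hr0, hre⟩ := ENNReal.lt_iff_exists_real_btwn.1 he
  have hr : 0 < r := ENNReal.ofReal_pos.1 hr0
  obtain ⟨u, hu, hlt⟩ := exists_lt_of_not_delta2 hΦ hΔ hδ (inv_pos.2 hr)
  have hnonneg := hΦ.2.2.2.1
  have hpos : 0 < Φ ((1 + δ) * u) :=
    (mul_nonneg (inv_pos.2 hr).le (hnonneg u)).trans_lt hlt
  refine ⟨u, ENNReal.ofReal (Φ ((1 + δ) * u))⁻¹, hu, ENNReal.ofReal_ne_top, ?_, ?_⟩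
  · rw [← ENNReal.ofReal_mul (hnonneg u)]
    refine (ENNReal.ofReal_le_ofReal ?_).trans hre.le
    rw [← div_eq_mul_inv, div_le_iff₀ hpos]
    rw [inv_mul_lt_iff₀ hr] at hlt
    exact hlt.le
  · rw [← ENNReal.ofReal_mul hpos.le, mul_inv_cancel₀ hpos.ne', ENNReal.ofReal_one]

lemma Iphi_comp_label {Ω : Type*} [MeasurableSpace Ω] {μ : Measure Ω} {Φ : ℝ → ℝ}
    (h0 : Φ 0 = 0) {L : Ω → ℕ} (hL : Measurable L) (H : ℕ → ℝ) (hH : H 0 = 0) :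
    Iphi μ Φ (fun t => H (L t)) =
      ∑' m, ENNReal.ofReal (Φ (H (m + 1))) * μ (L ⁻¹' {m + 1}) := by
  have hmap : Iphi μ Φ (fun t => H (L t)) = ∫⁻ m, ENNReal.ofReal (Φ (H m)) ∂(μ.map L) :=
    
    (lintegral_map (f := fun m => ENNReal.ofReal (Φ (H m))) measurable_from_nat hL).symm
  rw [hmap, lintegral_countable', tsum_eq_zero_add' ENNReal.summable]
  simp [hH, h0, Measure.map_apply hL]

section LatticeNorm

variable {p : ℝ × ℝ → ℝ}

lemma IsLatticeNorm.one_le (hp : IsLatticeNorm p) (h10 : p (1, 0) = 1) (s : ℝ) :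
    1 ≤ p (1, s) :=
  h10.symm.trans_le (hp.2.2.2 (1, 0) (1, s) le_rfl (by simp))

lemma IsLatticeNorm.le_one_add (hp : IsLatticeNorm p) (h10 : p (1, 0) = 1)
    (h01 : p (0, 1) = 1) {s : ℝ} (hs : 0 ≤ s) : p (1, s) ≤ 1 + s := by
  have h := hp.1 (1, 0) (s • (0, 1))
  rw [hp.2.1, h10, h01, abs_of_nonneg hs] at h
  simpa using h

variable {Ω : Type*} [MeasurableSpace Ω] {μ : Measure Ω} {Φ : ℝ → ℝ} {x : Ω → ℝ}

lemma aNorm_le_of_Iphi_le (hp : IsLatticeNorm p) (h10 : p (1, 0) = 1) (h01 : p (0, 1) = 1)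
    {ε r : ℝ} (hε : 0 ≤ ε) (hr : 0 < r)
    (h : Iphi μ Φ (fun t => r⁻¹ * x t) ≤ ENNReal.ofReal ε) :
    aNorm μ Φ p x ≤ ENNReal.ofReal ((1 + ε) * r) := by
  refine (iInf₂_le r⁻¹ (inv_pos.2 hr)).trans ?_
  rw [aTerm, if_neg (ne_top_of_le_ne_top ENNReal.ofReal_ne_top h), one_div, inv_inv, mul_comm r]
  gcongr
  refine (hp.le_one_add h10 h01 ENNReal.toReal_nonneg).trans ?_
  gcongr
  exact ENNReal.toReal_le_of_le_ofReal hε h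

lemma le_aNorm_of_Iphi_eq_top (hp : IsLatticeNorm p) (h10 : p (1, 0) = 1) {a : ℝ}
    (h : ∀ k, 0 < k → 1 < k * a → Iphi μ Φ (fun t => k * x t) = ⊤) :
    ENNReal.ofReal a ≤ aNorm μ Φ p x := by
  refine le_iInf₂ fun k hk => ?_
  unfold aTerm
  split_ifs with htop
  · exact le_top
  · have hka : k * a ≤ 1 := not_lt.1 fun hlt => htop (h k hk hlt)
    refine ENNReal.ofReal_le_ofReal ?_
    calc a ≤ 1 / k * 1 := by rwa [mul_one, le_div_iff₀ hk, mul_comm]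
      _ ≤ _ := by gcongr; exact hp.one_le h10 _

end LatticeNorm

/-- If `μ` is σ-finite, non-atomic and infinite, `p` is a lattice norm on `ℝ²` with
`p (1,0) = p (0,1) = 1`, and `Φ` is an Orlicz function failing `Δ₂(ℝ₊)`, then
`(L^Φ(μ), ‖·‖_{Φ,p})` contains an order linearly almost isometric copy of `ℓ^∞`. -/
theorem stmt4 {Ω : Type*} [MeasurableSpace Ω] (μ : Measure Ω) [SigmaFinite μ]
    (hna : NonAtomic μ) (hμ : μ Set.univ = ⊤)
    (Φ : ℝ → ℝ) (hΦ : IsOrlicz Φ) (hΔ : ¬ Delta2 Φ)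
    (p : ℝ × ℝ → ℝ) (hp : IsLatticeNorm p) (h10 : p (1, 0) = 1) (h01 : p (0, 1) = 1) :
    ∀ ε : ℝ, 0 < ε →
      ∃ P : lp (fun _ : ℕ => ℝ) ⊤ →ₗ[ℝ] (Ω → ℝ),
        (∀ z, MemLphi μ Φ (P z)) ∧
        (∀ z, (∀ n : ℕ, 0 ≤ z n) → ∀ᵐ t ∂μ, 0 ≤ P z t) ∧
        (∀ z, ENNReal.ofReal ‖z‖ ≤ aNorm μ Φ p (P z) ∧
          aNorm μ Φ p (P z) ≤ ENNReal.ofReal ((1 + ε) * ‖z‖)) := by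
  intro ε hε
  obtain ⟨e, he0, hesum⟩ := ENNReal.exists_pos_sum_of_countable'
    (ENNReal.ofReal_pos.2 hε).ne' ℕ
  have hδ : ∀ m : ℕ, (0 : ℝ) < 1 / ((m.unpair.2 : ℝ) + 1) := fun m => by positivity
  choose u c hu hc hsmall hlarge using fun m : ℕ =>
    exists_height_weight hΦ hΔ (hδ m) (he0 m)
  obtain ⟨L, hL, hLc⟩ := hna.exists_label hμ c hc
  let V : ℕ → ℝ := fun m => if m = 0 then 0 else u (m - 1)
  have hV : ∀ m, 0 ≤ V m := fun m => by
    by_cases hm : m = 0 <;> simp [V, hm, hu]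
  let P : lp (fun _ : ℕ => ℝ) ⊤ →ₗ[ℝ] (Ω → ℝ) :=
    { toFun := fun z t => z (L t - 1).unpair.1 * V (L t)
      map_add' := fun z z' => by ext t; simp [add_mul]
      map_smul' := fun a z => by ext t; simp [mul_assoc] }
  have hI : ∀ z k, Iphi μ Φ (fun t => k * P z t) =
      ∑' m : ℕ, ENNReal.ofReal (Φ (k * (z m.unpair.1 * u m))) * c m := by
    intro z k
    have h := Iphi_comp_label (μ := μ) hΦ.2.2.1 hL
      (fun m => k * (z (m - 1).unpair.1 * V m)) (by simp [V])
    refine h.trans (tsum_congr fun m => ?_)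
    simp [hLc, V]
  have hupper : ∀ z : lp (fun _ : ℕ => ℝ) ⊤, ∀ r, ‖z‖ ≤ r → 0 < r →
      Iphi μ Φ (fun t => r⁻¹ * P z t) ≤ ENNReal.ofReal ε := by
    intro z r hzr hr
    rw [hI]
    refine (ENNReal.tsum_le_tsum fun m => ?_).trans hesum.le
    refine le_trans ?_ (hsmall m)
    gcongr
    refine hΦ.mono ?_
    have hz : |z m.unpair.1| ≤ r := (lp.norm_apply_le_norm (by simp) z _).trans hzr
    rw [abs_mul, abs_mul, abs_of_pos (inv_pos.2 hr), inv_mul_le_iff₀ hr]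
    gcongr
  refine ⟨P, fun z => ⟨?_, ?_⟩, fun z hz => ae_of_all _ fun t => mul_nonneg (hz _) (hV _),
    fun z => ⟨?_, ?_⟩⟩
  · exact (measurable_from_nat (f := fun m => z (m - 1).unpair.1 * V m)).comp hL
  · have hr : 0 < ‖z‖ + 1 := by positivity
    exact ⟨(‖z‖ + 1)⁻¹, inv_pos.2 hr, ne_top_of_le_ne_top ENNReal.ofReal_ne_top
      (hupper z _ (le_add_of_nonneg_right zero_le_one) hr)⟩
  · refine le_aNorm_of_Iphi_eq_top hp h10 fun k hk hlt => ?_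
    obtain ⟨n, hn⟩ : ∃ n, 1 < k * |z n| := by
      by_contra! hcon
      refine hlt.not_ge ?_
      rw [← le_div_iff₀' hk]
      exact lp.norm_le_of_forall_le (by positivity) fun n => (le_div_iff₀' hk).2 (hcon n)
    obtain ⟨J, hJ⟩ := exists_nat_one_div_lt (sub_pos.2 hn)
    rw [hI, eq_top_iff]
    refine (ENNReal.tsum_const_eq_top_of_ne_zero (α := ℕ) one_ne_zero).ge.trans ?_
    have hinj : Function.Injective fun j : ℕ => Nat.pair n (j + J) := fun i j hij => by
      simpa [Nat.pair_eq_pair] using hij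
    refine le_trans (ENNReal.tsum_le_tsum fun j => ?_)
      (ENNReal.tsum_comp_le_tsum_of_injective hinj _)
    refine (hlarge (Nat.pair n (j + J))).trans ?_
    gcongr
    refine hΦ.mono ?_
    simp only [Nat.unpair_pair]
    rw [← mul_assoc, abs_mul, abs_mul _ (u _), abs_mul k, abs_of_pos hk]
    gcongr
    rw [abs_of_nonneg (by positivity)]
    have hjJ : 1 / (((j + J : ℕ) : ℝ) + 1) ≤ 1 / ((J : ℝ) + 1) := by
      gcongr
      exact Nat.le_add_left J j
    linarith
  · have hcont : Continuous fun r : ℝ => ENNReal.ofReal ((1 + ε) * r) :=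
      ENNReal.continuous_ofReal.comp (continuous_const_mul (1 + ε))
    refine ge_of_tendsto ((hcont.tendsto ‖z‖).mono_left nhdsWithin_le_nhds)
      (eventually_nhdsWithin_of_forall (s := Set.Ioi ‖z‖) fun r hr => ?_)
    have hr0 : 0 < r := (norm_nonneg z).trans_lt hr
    exact aNorm_le_of_Iphi_le hp h10 h01 hε.le hr0 (hupper z r (le_of_lt hr) hr0)
end
end
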